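/- For the kernel H(x,y) = (1/(4π))(1/cosh((x−y)/4) − 1/cosh((x+y)/4)), the function F_{2k+1}(t) = ∫₀^∞ x^{2k+1} H(x,t) dx is a monic polynomial in t of degree 2k+1; explicitly F_{2k+1}(t) = Σ_{i=0}^{k} t^{2i+1} C(2k+1, 2i+1) a_{k−i}, where the coefficients a_n are defined by 1/cos(2πx) = Σ_{n≥0} a_n x^{2n}/(2n)!. -/

import Mathlib

open Real MeasureTheory

/-- The kernel `H(x,y) = (1/(4π))(1/cosh((x−y)/4) − 1/cosh((x+y)/4))`. -/
noncomputable def Hker (x y : ℝ) : ℝ :=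
  (1 / (4 * Real.pi)) *
    (1 / Real.cosh ((x - y) / 4) - 1 / Real.cosh ((x + y) / 4))

/-- The Taylor coefficients `a_n` of `1/cos(2πx) = Σ a_n x^{2n}/(2n)!`,
defined via iterated derivatives at `0`. -/
noncomputable def secCoeff (n : ℕ) : ℝ :=
  iteratedDeriv (2 * n) (fun x : ℝ => (Real.cos (2 * Real.pi * x))⁻¹) 0

/-- The hyperbolic secant density `u ↦ 1 / (4π cosh (u / 4))`. -/
noncomputable def sechDensity (u : ℝ) : ℝ :=
  1 / (4 * π * cosh (u / 4))

lemma sechDensity_nonneg (u : ℝ) : 0 ≤ sechDensity u := by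
  have := cosh_pos (u / 4)
  unfold sechDensity
  positivity

lemma sechDensity_neg (u : ℝ) : sechDensity (-u) = sechDensity u := by
  simp [sechDensity, neg_div]

lemma measurable_sechDensity : Measurable sechDensity := by
  unfold sechDensity
  fun_prop

lemma Hker_eq_sechDensity (x t : ℝ) :
    Hker x t = sechDensity (x - t) - sechDensity (x + t) := by
  have h₁ := (cosh_pos ((x - t) / 4)).ne'
  have h₂ := (cosh_pos ((x + t) / 4)).ne'
  have := pi_ne_zero
  unfold Hker sechDensity
  field_simp

lemma sigmoid_half (u : ℝ) : sigmoid (u / 2) = exp (u / 4) * (2 * cosh (u / 4))⁻¹ := by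
  have h : exp (-(u / 2)) = exp (-(u / 4)) * exp (-(u / 4)) := by
    rw [← exp_add]; ring_nf
  have h' : exp (u / 4) * exp (-(u / 4)) = 1 := by rw [← exp_add]; simp
  have hp := exp_pos (u / 4)
  have hq := exp_pos (-(u / 4))
  rw [sigmoid_def, cosh_eq, h]
  field_simp
  linear_combination -exp (-(u / 4)) * h'

lemma one_sub_sigmoid_half (u : ℝ) :
    1 - sigmoid (u / 2) = exp (-(u / 4)) * (2 * cosh (u / 4))⁻¹ := by
  rw [← sigmoid_neg, ← neg_div, sigmoid_half, neg_div, cosh_neg]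

lemma hasDerivAt_sigmoid_half (u : ℝ) :
    HasDerivAt (fun v : ℝ ↦ sigmoid (v / 2))
      (sigmoid (u / 2) * (1 - sigmoid (u / 2)) * (1 / 2)) u :=
  HasDerivAt.comp (h₂ := sigmoid) u (hasDerivAt_sigmoid (u / 2)) ((hasDerivAt_id u).div_const 2)

lemma image_sigmoid_half : (fun u : ℝ ↦ sigmoid (u / 2)) '' Set.univ = Set.Ioo 0 1 := by
  rw [Set.image_univ, ← range_sigmoid]
  exact Function.Surjective.range_comp (fun y ↦ ⟨y * 2, by simp⟩) sigmoid

lemma injective_sigmoid_half : Function.Injective (fun u : ℝ ↦ sigmoid (u / 2)) := by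
  intro u v h
  have := sigmoid_injective h
  linarith

lemma beta_integrand_comp_sigmoid_half (τ u : ℝ) :
    |sigmoid (u / 2) * (1 - sigmoid (u / 2)) * (1 / 2)| •
      (((sigmoid (u / 2) : ℝ) : ℂ) ^ ((((1 / 2 + 2 * τ : ℝ) : ℂ)) - 1) *
        (1 - ((sigmoid (u / 2) : ℝ) : ℂ)) ^ (((1 / 2 - 2 * τ : ℝ) : ℂ) - 1)) =
      ((π * (sechDensity u * exp (τ * u)) : ℝ) : ℂ) := by
  have h0 := sigmoid_pos (u / 2)
  have h1 : 0 < 1 - sigmoid (u / 2) := sub_pos.2 (sigmoid_lt_one _)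
  have key : sigmoid (u / 2) * (1 - sigmoid (u / 2)) * (1 / 2) *
      (sigmoid (u / 2) ^ ((1 / 2 + 2 * τ) - 1) * (1 - sigmoid (u / 2)) ^ ((1 / 2 - 2 * τ) - 1)) =
      π * (sechDensity u * exp (τ * u)) := by
    have hc : 0 < (2 * cosh (u / 4))⁻¹ := by have := cosh_pos (u / 4); positivity
    have e1 : sigmoid (u / 2) * sigmoid (u / 2) ^ ((1 / 2 + 2 * τ) - 1) =
        sigmoid (u / 2) ^ (1 / 2 + 2 * τ) := by
      rw [rpow_sub_one h0.ne']; field_simp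
    have e2 : (1 - sigmoid (u / 2)) * (1 - sigmoid (u / 2)) ^ ((1 / 2 - 2 * τ) - 1) =
        (1 - sigmoid (u / 2)) ^ (1 / 2 - 2 * τ) := by
      rw [rpow_sub_one h1.ne']; field_simp
    have e3 : (2 * cosh (u / 4))⁻¹ ^ (1 / 2 + 2 * τ) * (2 * cosh (u / 4))⁻¹ ^ (1 / 2 - 2 * τ) =
        (2 * cosh (u / 4))⁻¹ := by
      rw [← rpow_add hc]
      ring_nf
      rw [rpow_one]
    have e4 : exp (u / 4) ^ (1 / 2 + 2 * τ) * exp (-(u / 4)) ^ (1 / 2 - 2 * τ) =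
        exp (τ * u) := by
      rw [← exp_mul, ← exp_mul, ← exp_add]
      ring_nf
    calc _ = (1 / 2) * (sigmoid (u / 2) * sigmoid (u / 2) ^ ((1 / 2 + 2 * τ) - 1)) *
          ((1 - sigmoid (u / 2)) * (1 - sigmoid (u / 2)) ^ ((1 / 2 - 2 * τ) - 1)) := by ring
      _ = (1 / 2) * (sigmoid (u / 2) ^ (1 / 2 + 2 * τ) *
          (1 - sigmoid (u / 2)) ^ (1 / 2 - 2 * τ)) := by rw [e1, e2]; ring
      _ = (1 / 2) * ((exp (u / 4) ^ (1 / 2 + 2 * τ) * exp (-(u / 4)) ^ (1 / 2 - 2 * τ)) *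
          ((2 * cosh (u / 4))⁻¹ ^ (1 / 2 + 2 * τ) *
            (2 * cosh (u / 4))⁻¹ ^ (1 / 2 - 2 * τ))) := by
        rw [one_sub_sigmoid_half, sigmoid_half, mul_rpow (exp_pos _).le hc.le,
          mul_rpow (exp_pos _).le hc.le]
        ring
      _ = _ := by
        have := (cosh_pos (u / 4)).ne'
        have := pi_ne_zero
        rw [e3, e4, sechDensity]
        field_simp
        norm_num
  rw [abs_of_pos (by positivity), ← key, Complex.real_smul]
  push_cast [Complex.ofReal_cpow h0.le, Complex.ofReal_cpow h1.le]
  rfl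

lemma integrable_sechDensity_mul_exp {τ : ℝ} (hτ : |τ| < 1 / 4) :
    Integrable (fun u ↦ sechDensity u * exp (τ * u)) := by
  obtain ⟨h₁, h₂⟩ := abs_lt.1 hτ
  have h := Complex.betaIntegral_convergent (u := ((1 / 2 + 2 * τ : ℝ) : ℂ))
    (v := ((1 / 2 - 2 * τ : ℝ) : ℂ)) (by rw [Complex.ofReal_re]; linarith)
    (by rw [Complex.ofReal_re]; linarith)
  rw [intervalIntegrable_iff_integrableOn_Ioo_of_le zero_le_one, ← image_sigmoid_half,
    integrableOn_image_iff_integrableOn_abs_deriv_smul MeasurableSet.univ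
      (fun u _ ↦ (hasDerivAt_sigmoid_half u).hasDerivWithinAt)
      injective_sigmoid_half.injOn, integrableOn_univ] at h
  simp only [beta_integrand_comp_sigmoid_half] at h
  have h' := h.re
  simp only [RCLike.re_to_complex, Complex.ofReal_re] at h'
  simpa [← mul_assoc, pi_ne_zero] using h'.const_mul π⁻¹

lemma integral_sechDensity_mul_exp {τ : ℝ} (hτ : |τ| < 1 / 4) :
    ∫ u, sechDensity u * exp (τ * u) = (cos (2 * π * τ))⁻¹ := by
  obtain ⟨h₁, h₂⟩ := abs_lt.1 hτ
  have hα : 0 < 1 / 2 + 2 * τ := by linarith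
  have hβ : 0 < 1 / 2 - 2 * τ := by linarith
  have hB := ProbabilityTheory.beta_eq_betaIntegralReal _ _ hα hβ
  rw [Complex.betaIntegral, intervalIntegral.integral_of_le zero_le_one,
    integral_Ioc_eq_integral_Ioo, ← image_sigmoid_half,
    integral_image_eq_integral_abs_deriv_smul MeasurableSet.univ
      (fun u _ ↦ (hasDerivAt_sigmoid_half u).hasDerivWithinAt)
      injective_sigmoid_half.injOn, setIntegral_univ] at hB
  simp only [beta_integrand_comp_sigmoid_half] at hB
  rw [integral_complex_ofReal, Complex.ofReal_re, integral_const_mul, ProbabilityTheory.beta,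
    show 1 / 2 - 2 * τ = 1 - (1 / 2 + 2 * τ) by ring, Real.Gamma_mul_Gamma_one_sub,
    add_sub_cancel, Real.Gamma_one, div_one,
    show π * (1 / 2 + 2 * τ) = 2 * π * τ + π / 2 by ring, sin_add_pi_div_two,
    div_eq_mul_inv] at hB
  exact (mul_left_cancel₀ pi_ne_zero hB).symm

/-- The hyperbolic secant distribution, with density `sechDensity`. -/
noncomputable def sechMeasure : Measure ℝ :=
  volume.withDensity fun u ↦ ENNReal.ofReal (sechDensity u)

lemma integrable_sechMeasure_iff {f : ℝ → ℝ} :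
    Integrable f sechMeasure ↔ Integrable fun u ↦ sechDensity u * f u := by
  rw [sechMeasure, integrable_withDensity_iff_integrable_smul'
    measurable_sechDensity.ennreal_ofReal (by simp)]
  simp only [ENNReal.toReal_ofReal (sechDensity_nonneg _), smul_eq_mul]

lemma integral_sechMeasure (f : ℝ → ℝ) :
    ∫ u, f u ∂sechMeasure = ∫ u, sechDensity u * f u := by
  rw [sechMeasure, integral_withDensity_eq_integral_toReal_smul
    measurable_sechDensity.ennreal_ofReal (by simp)]
  simp only [ENNReal.toReal_ofReal (sechDensity_nonneg _), smul_eq_mul]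

lemma zero_mem_interior_integrableExpSet_sechMeasure :
    0 ∈ interior (ProbabilityTheory.integrableExpSet id sechMeasure) := by
  rw [mem_interior_iff_mem_nhds]
  filter_upwards [Metric.ball_mem_nhds (0 : ℝ) (show (0 : ℝ) < 1 / 4 by norm_num)] with τ hτ
  rw [mem_ball_zero_iff, norm_eq_abs] at hτ
  exact integrable_sechMeasure_iff.2 (integrable_sechDensity_mul_exp hτ)

lemma mgf_sechMeasure_eventuallyEq :
    ProbabilityTheory.mgf id sechMeasure =ᶠ[nhds 0] fun τ ↦ (cos (2 * π * τ))⁻¹ := by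
  filter_upwards [Metric.ball_mem_nhds (0 : ℝ) (show (0 : ℝ) < 1 / 4 by norm_num)] with τ hτ
  rw [mem_ball_zero_iff, norm_eq_abs] at hτ
  rw [ProbabilityTheory.mgf, integral_sechMeasure]
  exact integral_sechDensity_mul_exp hτ

lemma integrable_sechDensity_mul_pow (n : ℕ) :
    Integrable fun u ↦ sechDensity u * u ^ n :=
  integrable_sechMeasure_iff.1 <|
    ProbabilityTheory.integrable_pow_of_mem_interior_integrableExpSet
      zero_mem_interior_integrableExpSet_sechMeasure n

lemma integral_sechDensity_mul_pow_even (n : ℕ) :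
    ∫ u, sechDensity u * u ^ (2 * n) = secCoeff n := by
  rw [secCoeff, ← mgf_sechMeasure_eventuallyEq.iteratedDeriv_eq,
    ProbabilityTheory.iteratedDeriv_mgf_zero zero_mem_interior_integrableExpSet_sechMeasure,
    integral_sechMeasure]
  rfl

lemma integral_sechDensity_mul_pow_of_odd {n : ℕ} (hn : Odd n) :
    ∫ u, sechDensity u * u ^ n = 0 := by
  have h := integral_neg_eq_self (fun u ↦ sechDensity u * u ^ n) volume
  simp only [sechDensity_neg, hn.neg_pow, mul_neg, integral_neg] at h
  linarith

lemma sechDensity_mul_add_pow (t : ℝ) (n : ℕ) (u : ℝ) :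
    sechDensity u * (t + u) ^ n =
      ∑ j ∈ Finset.range (n + 1), t ^ j * (n.choose j : ℝ) * (sechDensity u * u ^ (n - j)) := by
  rw [add_pow, Finset.mul_sum]
  exact Finset.sum_congr rfl fun j _ ↦ by ring

lemma integrable_sechDensity_mul_add_pow (t : ℝ) (n : ℕ) :
    Integrable fun u ↦ sechDensity u * (t + u) ^ n := by
  simp only [sechDensity_mul_add_pow]
  exact integrable_finsetSum _ fun j _ ↦ (integrable_sechDensity_mul_pow (n - j)).const_mul _

lemma integral_sechDensity_mul_add_pow (t : ℝ) (n : ℕ) :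
    ∫ u, sechDensity u * (t + u) ^ n =
      ∑ j ∈ Finset.range (n + 1),
        t ^ j * (n.choose j : ℝ) * ∫ u, sechDensity u * u ^ (n - j) := by
  simp only [sechDensity_mul_add_pow]
  rw [integral_finsetSum _ fun j _ ↦ (integrable_sechDensity_mul_pow (n - j)).const_mul _]
  simp only [integral_const_mul]

lemma sum_range_two_mul (f : ℕ → ℝ) (n : ℕ) :
    ∑ j ∈ Finset.range (2 * n), f j = ∑ i ∈ Finset.range n, (f (2 * i) + f (2 * i + 1)) := by
  induction n with
  | zero => simp
  | succ n ih => rw [mul_add_one, Finset.sum_range_succ, Finset.sum_range_succ,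
      Finset.sum_range_succ, ih, add_assoc]

lemma setIntegral_pow_mul_Hker (t : ℝ) {n : ℕ} (hn : Odd n) :
    ∫ x in Set.Ioi (0 : ℝ), x ^ n * Hker x t = ∫ u, sechDensity u * (t + u) ^ n := by
  set f : ℝ → ℝ := fun x ↦ sechDensity (x - t) * x ^ n with hf_def
  have hf : Integrable f := by
    simpa [hf_def] using (integrable_sechDensity_mul_add_pow t n).comp_sub_right t
  have hsplit (x : ℝ) : x ^ n * Hker x t = f x + f (-x) := by
    have : sechDensity (-x - t) = sechDensity (x + t) := by
      rw [← sechDensity_neg]; ring_nf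
    simp only [hf_def, Hker_eq_sechDensity, this, hn.neg_pow]
    ring
  calc ∫ x in Set.Ioi (0 : ℝ), x ^ n * Hker x t
      = (∫ x in Set.Ioi (0 : ℝ), f x) + ∫ x in Set.Ioi (0 : ℝ), f (-x) := by
        simp only [hsplit]
        exact integral_add hf.integrableOn hf.comp_neg.integrableOn
    _ = ∫ x, f x := by
        rw [integral_comp_neg_Ioi, neg_zero, add_comm,
          intervalIntegral.integral_Iic_add_Ioi hf.integrableOn hf.integrableOn]
    _ = ∫ u, sechDensity u * (t + u) ^ n := by
        rw [← integral_add_right_eq_self f t]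
        simp [hf_def, add_comm t]

/-- `F_{2k+1}(t) = ∫₀^∞ x^{2k+1} H(x,t) dx` is the monic degree `2k+1` polynomial
`Σ_{i=0}^{k} t^{2i+1} C(2k+1, 2i+1) a_{k−i}` (with `a_0 = 1`, so it is monic). -/
theorem stmt0 (k : ℕ) :
    secCoeff 0 = 1 ∧
    ∀ t : ℝ,
      (∫ x in Set.Ioi (0 : ℝ), x ^ (2 * k + 1) * Hker x t) =
        ∑ i ∈ Finset.range (k + 1),
          t ^ (2 * i + 1) * (Nat.choose (2 * k + 1) (2 * i + 1) : ℝ) *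
            secCoeff (k - i) := by
  refine ⟨by simp [secCoeff], fun t ↦ ?_⟩
  rw [setIntegral_pow_mul_Hker t ⟨k, rfl⟩, integral_sechDensity_mul_add_pow,
    show 2 * k + 1 + 1 = 2 * (k + 1) by ring, sum_range_two_mul]
  refine Finset.sum_congr rfl fun i hi ↦ ?_
  have hik : i ≤ k := Finset.mem_range_succ_iff.1 hi
  rw [integral_sechDensity_mul_pow_of_odd (n := 2 * k + 1 - 2 * i) ⟨k - i, by lia⟩,
    show 2 * k + 1 - (2 * i + 1) = 2 * (k - i) by lia, integral_sechDensity_mul_pow_even]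
  ring
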